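/- arXiv:math/0405092 — 2 statements merged into one kernel-verified Lean document; each statement's English description precedes it below -/
import Mathlib

section
/- For every γ with 0 < γ < 1 and every ε > 0 there is η > 0 such that for all but finitely many m ∈ ℕ the following holds: for every measurable E ⊆ 2^ℕ and every measurable D ⊆ E, if λ(D ∩ [s]) ≥ ε·λ(E ∩ [s]) for each binary sequence s of length m, then □_η(D) ≥ □_γ(E). -/
open MeasureTheory Filter Set Topology
open scoped ENNReal

noncomputable section

/-- The Cantor space `2^ℕ`. -/
abbrev Cantor : Type := ℕ → Bool

/-- The uniform product ("fair coin-flipping") probability measure on `2^ℕ`, realized as the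
pushforward of Lebesgue measure on `[0,1)` under the binary-digit map. -/
noncomputable def cantorMeasure : Measure Cantor :=
  Measure.map (fun x : ℝ => fun n : ℕ => decide (⌊x * 2 ^ (n + 1)⌋ % 2 = 1))
    (volume.restrict (Set.Ico (0 : ℝ) 1))

/-- The basic cylinder `[a]` determined by a finite binary sequence `a`. -/
def cyl (a : List Bool) : Set Cantor := {x | ∀ i : Fin a.length, x i = a.get i}

/-- `[A] = ⋃ a ∈ A, [a]`. -/
def cylSet (A : Set (List Bool)) : Set Cantor := ⋃ a ∈ A, cyl a

/-- The weight `2^(-|a|·r)` of a node `a`. -/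
noncomputable def wt (r : ℝ) (a : List Bool) : ℝ≥0∞ := (2 : ℝ≥0∞) ^ (-(a.length : ℝ) * r)

/-- `Σ_{a ∈ A} 2^(-|a|·r)`. -/
noncomputable def wtSum (r : ℝ) (A : Set (List Bool)) : ℝ≥0∞ := ∑' a : A, wt r (a : List Bool)

/-- `A ∈ C^∞_ε`, i.e. `Σ_{a ∈ A} 2^(-|a|·r) ≤ ε`. -/
def memCinf (r ε : ℝ) (A : Set (List Bool)) : Prop := wtSum r A ≤ ENNReal.ofReal ε

/-- The `r`-dimensional dyadic Hausdorff capacity `λ^r_∞`. -/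
noncomputable def hcap (r : ℝ) (X : Set Cantor) : ℝ≥0∞ :=
  ⨅ (A : Set (List Bool)) (_ : X ⊆ cylSet A), wtSum r A

/-- `□_δ(X) = inf {λ^r_∞(X \ Z) : Z measurable, λ Z < δ}`. -/
noncomputable def sqcap (r δ : ℝ) (X : Set Cantor) : ℝ≥0∞ :=
  ⨅ (Z : Set Cantor) (_ : MeasurableSet Z) (_ : cantorMeasure Z < ENNReal.ofReal δ),
    hcap r (X \ Z)

theorem floor_mul_two_pow_eq_of_digits_eq {x y : ℝ} (hx : x ∈ Ico (0 : ℝ) 1)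
    (hy : y ∈ Ico (0 : ℝ) 1) (n : ℕ)
    (h : ∀ i < n, (⌊x * 2 ^ (i + 1)⌋ % 2 = 1 ↔ ⌊y * 2 ^ (i + 1)⌋ % 2 = 1)) :
    ⌊x * 2 ^ n⌋ = ⌊y * 2 ^ n⌋ := by
  induction n with
  | zero =>
    have hx0 : ⌊x⌋ = 0 := Int.floor_eq_zero_iff.2 hx
    have hy0 : ⌊y⌋ = 0 := Int.floor_eq_zero_iff.2 hy
    simp [hx0, hy0]
  | succ n ih =>
    have key : ∀ z : ℝ, ⌊z * 2 ^ (n + 1)⌋ / 2 = ⌊z * 2 ^ n⌋ := by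
      intro z
      have hz := Int.floor_div_natCast (z * 2 ^ (n + 1)) 2
      rw [show z * 2 ^ (n + 1) / ((2 : ℕ) : ℝ) = z * 2 ^ n by push_cast; ring] at hz
      exact_mod_cast hz.symm
    have ih' := ih fun i hi => h i (by omega)
    have h1 := key x
    have h2 := key y
    have h3 := h n (by omega)
    omega

theorem measurable_binaryDigits :
    Measurable (fun x : ℝ => fun n : ℕ => decide (⌊x * 2 ^ (n + 1)⌋ % 2 = 1)) := by
  refine measurable_pi_lambda _ fun n => ?_
  have h : Measurable fun x : ℝ => ⌊x * 2 ^ (n + 1)⌋ :=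
    Int.measurable_floor.comp (measurable_id.mul_const _)
  exact (measurable_from_top (f := fun k : ℤ => decide (k % 2 = 1))).comp h

theorem measurableSet_cyl (a : List Bool) : MeasurableSet (cyl a) := by
  have : cyl a = ⋂ i : Fin a.length, (fun x : Cantor => x i) ⁻¹' {a.get i} := by
    ext x
    simp [cyl]
  rw [this]
  exact MeasurableSet.iInter fun i => measurable_pi_apply _ (MeasurableSet.singleton _)

theorem measurableSet_cylSet (A : Set (List Bool)) : MeasurableSet (cylSet A) :=
  MeasurableSet.biUnion A.to_countable fun a _ => measurableSet_cyl a

theorem cantorMeasure_cyl_le (a : List Bool) :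
    cantorMeasure (cyl a) ≤ (2 : ℝ≥0∞) ^ (-(a.length : ℝ)) := by
  rw [cantorMeasure, Measure.map_apply measurable_binaryDigits (measurableSet_cyl a),
    Measure.restrict_apply (measurable_binaryDigits (measurableSet_cyl a))]
  set S := (fun x : ℝ => fun n : ℕ => decide (⌊x * 2 ^ (n + 1)⌋ % 2 = 1)) ⁻¹' cyl a ∩ Ico (0 : ℝ) 1
    with hS
  rcases S.eq_empty_or_nonempty with h | ⟨y, hy⟩
  · simp [h]
  · have hsub : S ⊆ Ico ((⌊y * 2 ^ a.length⌋ : ℝ) / 2 ^ a.length)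
        ((⌊y * 2 ^ a.length⌋ + 1 : ℝ) / 2 ^ a.length) := by
      intro x hx
      have hfl : ⌊x * 2 ^ a.length⌋ = ⌊y * 2 ^ a.length⌋ := by
        refine floor_mul_two_pow_eq_of_digits_eq hx.2 hy.2 _ fun i hi => ?_
        have h1 := hx.1 ⟨i, hi⟩
        have h2 := hy.1 ⟨i, hi⟩
        exact decide_eq_decide.1 (h1.trans h2.symm)
      rw [← hfl]
      refine ⟨?_, ?_⟩
      · rw [div_le_iff₀ (by positivity)]
        exact Int.floor_le _
      · rw [lt_div_iff₀ (by positivity)]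
        exact Int.lt_floor_add_one _
    refine (measure_mono hsub).trans (le_of_eq ?_)
    rw [Real.volume_Ico, ← sub_div, add_sub_cancel_left, ENNReal.rpow_neg, ENNReal.rpow_natCast,
      one_div, ENNReal.ofReal_inv_of_pos (by positivity), ENNReal.ofReal_pow (by norm_num)]
    simp

theorem mem_cyl_of_mem_cyl_of_length_le {x y : Cantor} {s a : List Bool} (hx : x ∈ cyl s)
    (hy : y ∈ cyl s) (hya : y ∈ cyl a) (hle : a.length ≤ s.length) : x ∈ cyl a := by
  intro i
  have h1 := hx ⟨i, i.2.trans_le hle⟩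
  have h2 := hy ⟨i, i.2.trans_le hle⟩
  exact (h1.trans h2.symm).trans (hya i)

theorem mem_cyl_ofFn {m : ℕ} {f : Fin m → Bool} {x : Cantor} :
    x ∈ cyl (List.ofFn f) ↔ ∀ i : Fin m, x i = f i := by
  constructor
  · intro h i
    simpa using h ⟨i, by simp⟩
  · intro h i
    simpa using h ⟨i, by simpa using i.2⟩

theorem wtSum_mono (r : ℝ) {A B : Set (List Bool)} (h : A ⊆ B) : wtSum r A ≤ wtSum r B :=
  ENNReal.tsum_mono_subtype _ h

theorem hcap_le_one (r : ℝ) (X : Set Cantor) : hcap r X ≤ 1 := by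
  refine (iInf₂_le {([] : List Bool)} ?_).trans ?_
  · intro x _
    simp [cylSet, cyl]
  · simp [wtSum, wt]

/-- Long cylinders of total `r`-weight at most one have small measure. -/
theorem cantorMeasure_cylSet_le {r : ℝ} (hr : r < 1) {m : ℕ} {A : Set (List Bool)}
    (hA : ∀ a ∈ A, m ≤ a.length) (hw : wtSum r A ≤ 1) :
    cantorMeasure (cylSet A) ≤ (2 : ℝ≥0∞) ^ (-(m : ℝ) * (1 - r)) := by
  calc cantorMeasure (cylSet A)
      ≤ ∑' a : A, cantorMeasure (cyl a) := measure_biUnion_le _ A.to_countable _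
    _ ≤ ∑' a : A, (2 : ℝ≥0∞) ^ (-(m : ℝ) * (1 - r)) * wt r a := by
        refine ENNReal.tsum_le_tsum fun a => (cantorMeasure_cyl_le a).trans ?_
        rw [wt, ← ENNReal.rpow_add _ _ (by norm_num) (by norm_num)]
        refine ENNReal.rpow_le_rpow_of_exponent_le (by norm_num) ?_
        have : (m : ℝ) ≤ (a : List Bool).length := by exact_mod_cast hA a a.2
        nlinarith
    _ = (2 : ℝ≥0∞) ^ (-(m : ℝ) * (1 - r)) * wtSum r A := ENNReal.tsum_mul_left
    _ ≤ _ := (mul_le_mul_right hw _).trans_eq (mul_one _)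

/-- A density comparison on all cylinders of length `m` persists off any union of cylinders of
length at most `m`. -/
theorem mul_measure_diff_cylSet_le {μ : Measure Cantor} {m : ℕ} {c : ℝ≥0∞} {E D : Set Cantor}
    (hD : MeasurableSet D)
    (h : ∀ s : List Bool, s.length = m → c * μ (E ∩ cyl s) ≤ μ (D ∩ cyl s))
    {A : Set (List Bool)} (hA : ∀ a ∈ A, a.length ≤ m) :
    c * μ (E \ cylSet A) ≤ μ (D \ cylSet A) := by
  classical
  let G : Finset (Fin m → Bool) :=
    Finset.univ.filter fun f => Disjoint (cyl (List.ofFn f)) (cylSet A)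
  have hE : E \ cylSet A ⊆ ⋃ f ∈ G, E ∩ cyl (List.ofFn f) := by
    rintro x ⟨hxE, hxA⟩
    have hx : x ∈ cyl (List.ofFn fun i : Fin m => x i) := mem_cyl_ofFn.2 fun _ => rfl
    refine mem_biUnion (x := fun i : Fin m => x i) ?_ ⟨hxE, hx⟩
    simp only [G, Finset.coe_filter, Finset.mem_univ, true_and, mem_ofPred_eq]
    refine Set.disjoint_left.2 fun y hy hyA => hxA ?_
    obtain ⟨a, ha, hya⟩ := mem_iUnion₂.1 hyA
    exact mem_iUnion₂.2
      ⟨a, ha, mem_cyl_of_mem_cyl_of_length_le hx hy hya (by simpa using hA a ha)⟩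
  calc c * μ (E \ cylSet A)
      ≤ c * ∑ f ∈ G, μ (E ∩ cyl (List.ofFn f)) := by
        gcongr
        exact (measure_mono hE).trans (measure_biUnion_finset_le _ _)
    _ = ∑ f ∈ G, c * μ (E ∩ cyl (List.ofFn f)) := Finset.mul_sum _ _ _
    _ ≤ ∑ f ∈ G, μ (D ∩ cyl (List.ofFn f)) :=
        Finset.sum_le_sum fun f _ => h _ (List.length_ofFn)
    _ = μ (⋃ f ∈ G, D ∩ cyl (List.ofFn f)) := by
        refine (measure_biUnion_finset ?_ fun f _ => hD.inter (measurableSet_cyl _)).symm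
        intro f _ g _ hfg
        refine Set.disjoint_left.2 fun x hf hg => hfg (funext fun i => ?_)
        exact (mem_cyl_ofFn.1 hf.2 i).symm.trans (mem_cyl_ofFn.1 hg.2 i)
    _ ≤ μ (D \ cylSet A) := by
        refine measure_mono (iUnion₂_subset fun f hf x hx => ⟨hx.1, ?_⟩)
        exact Set.disjoint_left.1 (Finset.mem_filter.1 hf).2 hx.2

theorem tendsto_two_rpow_neg_mul {c : ℝ} (hc : 0 < c) :
    Tendsto (fun m : ℕ => (2 : ℝ≥0∞) ^ (-(m : ℝ) * c)) atTop (𝓝 0) := by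
  have h : ∀ m : ℕ, (2 : ℝ≥0∞) ^ (-(m : ℝ) * c) = ((2 : ℝ≥0∞) ^ (-c)) ^ m := by
    intro m
    rw [← ENNReal.rpow_mul_natCast]
    congr 1
    ring
  simp_rw [h]
  exact ENNReal.tendsto_pow_atTop_nhds_zero_of_lt_one
    (ENNReal.rpow_lt_one_of_one_lt_of_neg (by norm_num) (by linarith))

theorem statement0 (r : ℝ) (hr0 : 0 < r) (hr1 : r < 1)
    (γ : ℝ) (hγ0 : 0 < γ) (hγ1 : γ < 1) (ε : ℝ) (hε : 0 < ε) :
    ∃ η : ℝ, 0 < η ∧ ∀ᶠ m : ℕ in Filter.atTop,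
      ∀ E D : Set Cantor, MeasurableSet E → MeasurableSet D → D ⊆ E →
        (∀ s : List Bool, s.length = m →
          ENNReal.ofReal ε * cantorMeasure (E ∩ cyl s) ≤ cantorMeasure (D ∩ cyl s)) →
        sqcap r γ E ≤ sqcap r η D := by
  have hη : 0 < ε * γ / 2 := by positivity
  refine ⟨ε * γ / 2, hη, ?_⟩
  filter_upwards [(tendsto_two_rpow_neg_mul (sub_pos.2 hr1)).eventually
    (gt_mem_nhds (ENNReal.ofReal_pos.2 hη))] with m hm E D hE hD _ h
  refine le_iInf₂ fun Z _ => le_iInf fun hZ => le_iInf₂ fun A hA => ?_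
  rcases le_total 1 (wtSum r A) with hw | hw
  · refine (iInf₂_le ∅ MeasurableSet.empty).trans
      ((iInf_le _ ?_).trans ((hcap_le_one r _).trans hw))
    simpa using hγ0
  set S : Set (List Bool) := {a ∈ A | a.length ≤ m}
  set L : Set (List Bool) := {a ∈ A | m ≤ a.length}
  have hcover : D \ cylSet S ⊆ Z ∪ cylSet L := by
    rintro x ⟨hxD, hxS⟩
    by_cases hxZ : x ∈ Z
    · exact Or.inl hxZ
    · obtain ⟨a, ha, hxa⟩ := mem_iUnion₂.1 (hA ⟨hxD, hxZ⟩)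
      rcases le_total a.length m with hl | hl
      · exact absurd (mem_iUnion₂.2 ⟨a, ⟨ha, hl⟩, hxa⟩) hxS
      · exact Or.inr (mem_iUnion₂.2 ⟨a, ⟨ha, hl⟩, hxa⟩)
  have hL : cantorMeasure (cylSet L) < ENNReal.ofReal (ε * γ / 2) :=
    (cantorMeasure_cylSet_le hr1 (fun a ha => ha.2)
      ((wtSum_mono r (sep_subset _ _)).trans hw)).trans_lt hm
  have hsmall : cantorMeasure (E \ cylSet S) < ENNReal.ofReal γ := by
    refine lt_of_mul_lt_mul_left' (a := ENNReal.ofReal ε) ?_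
    calc ENNReal.ofReal ε * cantorMeasure (E \ cylSet S)
        ≤ cantorMeasure (D \ cylSet S) := mul_measure_diff_cylSet_le hD h fun a ha => ha.2
      _ ≤ cantorMeasure Z + cantorMeasure (cylSet L) :=
          (measure_mono hcover).trans (measure_union_le _ _)
      _ < ENNReal.ofReal (ε * γ / 2) + ENNReal.ofReal (ε * γ / 2) := ENNReal.add_lt_add hZ hL
      _ = ENNReal.ofReal ε * ENNReal.ofReal γ := by
          rw [← ENNReal.ofReal_add hη.le hη.le, ← ENNReal.ofReal_mul hε.le, add_halves]
  refine (iInf₂_le _ (hE.diff (measurableSet_cylSet S))).trans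
    ((iInf_le _ hsmall).trans ((iInf₂_le S ?_).trans (wtSum_mono r (sep_subset _ _))))
  rw [sdiff_sdiff_right_self]
  exact inter_subset_right
end
end

section
/- Let Θ, Γ : ℕ → (0,∞), let X ⊆ (2^ℕ)^d satisfy □_{Θ,Γ}(X), and let η > 0 satisfy η < Θ(i) for each i < d. If A ⊆ (2^ℕ)^d has λ-outer measure less than η^d, then □_{Θ−η,Γ}(X∖A) holds, where (Θ−η)(i) = Θ(i) − η. -/
open MeasureTheory Filter Set Topology
open scoped ENNReal

noncomputable section

/-- The relation `□_{Θ,Γ}(X)` for `X ⊆ (2^ℕ)^(d+1)` (the index `d` codes dimension `d+1`):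
for dimension `1` it says `□_{Θ 0}(X) ≥ Γ 0`, and for dimension `n+2` it says
`□_{Θ (n+1)}({x : □_{Θ,Γ}(X(x,·))}) ≥ Γ (n+1)`, slicing along the first coordinate. -/
def SqTG (r : ℝ) (Θ Γ : ℕ → ℝ) : (d : ℕ) → Set (Fin (d + 1) → Cantor) → Prop
  | 0, X => ENNReal.ofReal (Γ 0) ≤ sqcap r (Θ 0) {y : Cantor | (fun _ : Fin 1 => y) ∈ X}
  | (n + 1), X => ENNReal.ofReal (Γ (n + 1)) ≤
      sqcap r (Θ (n + 1))
        {x : Cantor | SqTG r Θ Γ n {y : Fin (n + 1) → Cantor | Fin.cons x y ∈ X}}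

instance isFiniteMeasure_cantorMeasure : IsFiniteMeasure cantorMeasure := by
  unfold cantorMeasure
  infer_instance

theorem hcap_mono (r : ℝ) {S T : Set Cantor} (h : S ⊆ T) : hcap r S ≤ hcap r T :=
  le_iInf₂ fun A hA => iInf₂_le A (h.trans hA)

/-- Up to a set of measure less than `η`, enlarging a set costs at most `η` in the parameter
of `sqcap`. -/
theorem sqcap_le_sqcap_sub_of_diff_subset (r : ℝ) {δ η : ℝ} (hη : 0 ≤ η) (hδ : η ≤ δ)
    {S S' B : Set Cantor} (hB : cantorMeasure B < ENNReal.ofReal η) (hS : S \ B ⊆ S') :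
    sqcap r δ S ≤ sqcap r (δ - η) S' := by
  refine le_iInf₂ fun Z hZ => le_iInf fun hZδ => ?_
  have hlt : cantorMeasure (Z ∪ toMeasurable cantorMeasure B) < ENNReal.ofReal δ := by
    calc cantorMeasure (Z ∪ toMeasurable cantorMeasure B)
        ≤ cantorMeasure Z + cantorMeasure (toMeasurable cantorMeasure B) := measure_union_le _ _
      _ = cantorMeasure Z + cantorMeasure B := by rw [measure_toMeasurable]
      _ < ENNReal.ofReal (δ - η) + ENNReal.ofReal η := ENNReal.add_lt_add hZδ hB
      _ = ENNReal.ofReal δ := by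
        rw [← ENNReal.ofReal_add (sub_nonneg.2 hδ) hη, sub_add_cancel]
  refine (iInf₂_le _ (hZ.union (measurableSet_toMeasurable _ _))).trans <|
    (iInf_le _ hlt).trans <| hcap_mono r ?_
  rintro x ⟨hxS, hx⟩
  exact ⟨hS ⟨hxS, fun hxB => hx (Or.inr (subset_toMeasurable _ _ hxB))⟩, fun hxZ => hx (Or.inl hxZ)⟩

/-- If a set in a finite power has outer measure less than `a * b`, then fewer than `a` of its
slices along the first coordinate have outer measure at least `b`. -/
theorem measure_pi_slice_ge_lt {α : Type*} [MeasurableSpace α] (μ : Measure α) [SigmaFinite μ]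
    (n : ℕ) (A : Set (Fin (n + 1) → α)) {a b : ℝ≥0∞} (hb₀ : b ≠ 0) (hb : b ≠ ∞)
    (hA : Measure.pi (fun _ : Fin (n + 1) => μ) A < a * b) :
    μ {x | b ≤ Measure.pi (fun _ : Fin n => μ) {y | (Fin.cons x y : Fin (n + 1) → α) ∈ A}} < a := by
  set ν := Measure.pi fun _ : Fin n => μ
  have hmp := (measurePreserving_piFinSuccAbove (fun _ : Fin (n + 1) => μ) 0).symm
  set A' : Set (α × (Fin n → α)) :=
    (MeasurableEquiv.piFinSuccAbove (fun _ : Fin (n + 1) => α) 0).symm ⁻¹' A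
  have hA' : (μ.prod ν) A' < a * b := by
    rwa [← hmp.measure_preimage_equiv] at hA
  set M := toMeasurable (μ.prod ν) A'
  have hM : MeasurableSet M := measurableSet_toMeasurable _ _
  have hmarkov : b * μ {x | b ≤ ν (Prod.mk x ⁻¹' M)} ≤ (μ.prod ν) A' := by
    rw [← measure_toMeasurable A', Measure.prod_apply hM]
    exact mul_meas_ge_le_lintegral (measurable_measure_prodMk_left hM) b
  have hsub : {x | b ≤ ν {y | (Fin.cons x y : Fin (n + 1) → α) ∈ A}} ⊆
      {x | b ≤ ν (Prod.mk x ⁻¹' M)} := by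
    intro x hx
    refine le_trans (α := ℝ≥0∞) hx (measure_mono fun y hy => subset_toMeasurable _ _ ?_)
    simpa [A', MeasurableEquiv.piFinSuccAbove, Fin.insertNthEquiv] using hy
  refine (measure_mono hsub).trans_lt ((ENNReal.mul_lt_mul_iff_right hb₀ hb).1 ?_)
  exact hmarkov.trans_lt (mul_comm a b ▸ hA')

/-- here `d = e + 1 ≥ 1` and `X ⊆ (2^ℕ)^d`. -/
theorem statement6 (r : ℝ) (hr0 : 0 < r) (hr1 : r < 1)
    (Θ Γ : ℕ → ℝ) (hΘpos : ∀ i, 0 < Θ i) (hΓpos : ∀ i, 0 < Γ i)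
    (e : ℕ) (X : Set (Fin (e + 1) → Cantor)) (hX : SqTG r Θ Γ e X)
    (η : ℝ) (hη0 : 0 < η) (hη : ∀ i < e + 1, η < Θ i)
    (A : Set (Fin (e + 1) → Cantor))
    (hA : (Measure.pi fun _ : Fin (e + 1) => cantorMeasure) A <
      ENNReal.ofReal (η ^ (e + 1))) :
    SqTG r (fun i => Θ i - η) Γ e (X \ A) := by
  induction e with
  | zero =>
    refine le_trans (α := ℝ≥0∞) hX ?_
    refine sqcap_le_sqcap_sub_of_diff_subset r hη0.le (hη 0 (by omega)).le
      (B := {y | (fun _ : Fin 1 => y) ∈ A}) ?_ fun y hy => ⟨hy.1, hy.2⟩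
    have h := (measurePreserving_funUnique cantorMeasure (Fin 1)).symm.measure_preimage_equiv A
    exact h.trans_lt (hA.trans_eq (congrArg ENNReal.ofReal (pow_one η)))
  | succ n ih =>
    have hpow : 0 < η ^ (n + 1) := pow_pos hη0 _
    have hlt := measure_pi_slice_ge_lt cantorMeasure (n + 1) A (a := ENNReal.ofReal η)
      (b := ENNReal.ofReal (η ^ (n + 1))) (ENNReal.ofReal_pos.2 hpow).ne' ENNReal.ofReal_ne_top
      (by rwa [← ENNReal.ofReal_mul hη0.le, ← pow_succ'])
    refine le_trans (α := ℝ≥0∞) hX ?_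
    refine sqcap_le_sqcap_sub_of_diff_subset r hη0.le (hη (n + 1) (by omega)).le hlt ?_
    rintro x ⟨hx, hxB⟩
    exact ih _ hx (fun i hi => hη i (by omega)) _ (not_le.1 hxB)
end
end
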